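/- arXiv:1103.6170 — 2 statements merged into one kernel-verified Lean document; each statement's English description precedes it below -/
import Mathlib

section
/- Let N ≥ 1, −1 < s < 0 and 0 < T ≤ 1. There is a constant C = C(s,N) such that for every family (β_k)_{k∈ℤ^N} of nonnegative reals with ∑_{k∈ℤ^N} β_k (1+4π²|k|²)^s < ∞, one has ‖ ∑_{k∈ℤ^N} β_k e^{−8π²|k|² t} ‖_{L^{2/(1−s)}(0,T)} ≤ C T^{(1+s)/2} ∑_{k∈ℤ^N} β_k (1+4π²|k|²)^s. -/
open MeasureTheory Real

/-- Jensen's inequality for a weighted series with values in `[0, ∞]`. -/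
theorem ENNReal.tsum_mul_rpow_le {ι : Type*} (w f : ι → ENNReal) {p : ℝ} (hp : 1 ≤ p) :
    (∑' i, w i * f i) ^ p ≤ (∑' i, w i) ^ (p - 1) * ∑' i, w i * f i ^ p := by
  have hp0 : 0 < p := by linarith
  have h : ∑' i, w i * f i ≤ (∑' i, w i) ^ (1 - p⁻¹) * (∑' i, w i * f i ^ p) ^ p⁻¹ := by
    rw [ENNReal.tsum_eq_iSup_sum]
    refine iSup_le fun s => (ENNReal.inner_le_weight_mul_Lp_of_nonneg s hp w f).trans ?_
    have hp1 : 0 ≤ 1 - p⁻¹ := sub_nonneg.2 (inv_le_one_of_one_le₀ hp)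
    gcongr
    · exact ENNReal.sum_le_tsum s
    · exact ENNReal.sum_le_tsum (f := fun i => w i * f i ^ p) s
  refine (ENNReal.rpow_le_rpow h hp0.le).trans_eq ?_
  rw [ENNReal.mul_rpow_of_nonneg _ _ hp0.le, ← ENNReal.rpow_mul, ← ENNReal.rpow_mul,
    inv_mul_cancel₀ hp0.ne', ENNReal.rpow_one, sub_mul, inv_mul_cancel₀ hp0.ne', one_mul]

/-- The real-valued sum of a nonnegative family never exceeds its sum in `[0, ∞]`. -/
theorem ENNReal.ofReal_tsum_le {ι : Type*} {f : ι → ℝ} (hf : ∀ i, 0 ≤ f i) :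
    ENNReal.ofReal (∑' i, f i) ≤ ∑' i, ENNReal.ofReal (f i) := by
  by_cases h : Summable f
  · exact (ENNReal.ofReal_tsum_of_nonneg hf h).le
  · simp [tsum_eq_zero_of_not_summable h]

theorem integral_exp_neg_mul_le {l T : ℝ} (hl : 0 ≤ l) (hT : 0 ≤ T) :
    ∫ t in (0 : ℝ)..T, Real.exp (-l * t) ≤ T := by
  calc ∫ t in (0 : ℝ)..T, Real.exp (-l * t) ≤ ∫ _ in (0 : ℝ)..T, (1 : ℝ) := by
        refine intervalIntegral.integral_mono_on hT (Continuous.intervalIntegrable (by fun_prop) _ _)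
          (by simp) fun t ht => Real.exp_le_one_iff.2 ?_
        nlinarith [mul_nonneg hl ht.1]
    _ = T := by simp

theorem one_add_mul_integral_exp_neg_mul_le {l T : ℝ} (hl : 0 ≤ l) (hT : 0 ≤ T) :
    (1 + l) * ∫ t in (0 : ℝ)..T, Real.exp (-l * t) ≤ T + 1 := by
  have h : ∫ t in (0 : ℝ)..T, l * Real.exp (-l * t) = -Real.exp (-l * T) - -Real.exp (-l * 0) := by
    refine intervalIntegral.integral_eq_sub_of_hasDerivAt (f := fun t => -Real.exp (-l * t))
      (fun t _ => ?_) (Continuous.intervalIntegrable (by fun_prop) _ _)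
    have h1 := (((hasDerivAt_id t).const_mul (-l)).exp).neg
    simp only [id, mul_one] at h1
    exact h1.congr_deriv (by ring)
  rw [intervalIntegral.integral_const_mul, mul_zero, Real.exp_zero] at h
  linarith [integral_exp_neg_mul_le hl hT, Real.exp_pos (-l * T)]

/-- The `p`-th power of the `L^p(0,T)` bound for a single exponential, `p = 2 / (1 - s)`. -/
theorem lintegral_weighted_exp_rpow_le {s l T : ℝ} (hs₁ : -1 < s) (hs₂ : s < 0) (hl : 0 ≤ l)
    (hT : 0 < T) (hT1 : T ≤ 1) :
    ∫⁻ t in Set.Ioc (0 : ℝ) T,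
        ENNReal.ofReal ((1 + l) ^ (-s) * Real.exp (-(2 * l) * t)) ^ (2 / (1 - s)) ≤
      ENNReal.ofReal ((2 * T ^ ((1 + s) / 2)) ^ (2 / (1 - s))) := by
  set p : ℝ := 2 / (1 - s) with hp
  have h1s : 0 < 1 - s := by linarith
  have hp1 : 1 ≤ p := by rw [hp, le_div_iff₀ h1s]; linarith
  have hp0 : 0 < p := by linarith
  have hl1 : 0 < 1 + l := by linarith
  set J := ∫ t in (0 : ℝ)..T, Real.exp (-l * t) with hJ
  have hJ0 : 0 ≤ J := intervalIntegral.integral_nonneg hT.le fun t _ => (Real.exp_pos _).le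
  have hJT : J ≤ T := integral_exp_neg_mul_le hl hT.le
  have hJ2 : (1 + l) * J ≤ 2 :=
    (one_add_mul_integral_exp_neg_mul_le hl hT.le).trans (by linarith)
  have hsplit : J = J ^ (-s * p) * J ^ ((1 + s) / 2 * p) := by
    rw [← Real.rpow_add_of_nonneg hJ0 (by nlinarith) (by nlinarith)]
    have : -s * p + (1 + s) / 2 * p = 1 := by rw [hp]; field_simp; ring
    rw [this, Real.rpow_one]
  calc ∫⁻ t in Set.Ioc (0 : ℝ) T, ENNReal.ofReal ((1 + l) ^ (-s) * Real.exp (-(2 * l) * t)) ^ p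
      ≤ ∫⁻ t in Set.Ioc (0 : ℝ) T, ENNReal.ofReal ((1 + l) ^ (-s * p) * Real.exp (-l * t)) := by
        refine setLIntegral_mono (by fun_prop) fun t ht => ?_
        rw [ENNReal.ofReal_rpow_of_nonneg (by positivity) hp0.le,
          Real.mul_rpow (by positivity) (by positivity), ← Real.rpow_mul hl1.le, ← Real.exp_mul]
        refine ENNReal.ofReal_le_ofReal (mul_le_mul_of_nonneg_left (Real.exp_le_exp.2 ?_)
          (by positivity))
        nlinarith [mul_nonneg hl ht.1.le, mul_nonneg (mul_nonneg hl ht.1.le) (sub_nonneg.2 hp1)]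
    _ = ENNReal.ofReal ((1 + l) ^ (-s * p) * J) := by
        rw [hJ, intervalIntegral.integral_of_le hT.le, ← integral_const_mul,
          ofReal_integral_eq_lintegral_ofReal]
        · exact (Continuous.integrableOn_Ioc (by fun_prop))
        · exact Filter.Eventually.of_forall fun t => by positivity
    _ ≤ ENNReal.ofReal ((2 * T ^ ((1 + s) / 2)) ^ p) := by
        refine ENNReal.ofReal_le_ofReal ?_
        have hsp : 0 ≤ -s * p := by nlinarith
        calc (1 + l) ^ (-s * p) * J
            = ((1 + l) * J) ^ (-s * p) * J ^ ((1 + s) / 2 * p) := by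
              rw [Real.mul_rpow hl1.le hJ0, mul_assoc, ← hsplit]
          _ ≤ 2 ^ p * T ^ ((1 + s) / 2 * p) := by
              have hsp' : 0 ≤ (1 + s) / 2 * p := by nlinarith
              refine mul_le_mul ((Real.rpow_le_rpow (by positivity) hJ2 hsp).trans ?_)
                (Real.rpow_le_rpow hJ0 hJT hsp') (by positivity) (by positivity)
              exact Real.rpow_le_rpow_of_exponent_le (by norm_num) (by nlinarith)
          _ = (2 * T ^ ((1 + s) / 2)) ^ p := by
              rw [Real.mul_rpow (by norm_num) (by positivity), ← Real.rpow_mul hT.le]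

/-- for `N ≥ 1`, `−1 < s < 0`, there is `C = C(s,N)` such that for all
`0 < T ≤ 1` and all nonnegative `(β_k)_{k ∈ ℤ^N}` with
`∑_k β_k (1+4π²|k|²)^s < ∞` one has
`‖ ∑_k β_k e^{−8π²|k|² t} ‖_{L^{2/(1−s)}(0,T)} ≤ C T^{(1+s)/2} ∑_k β_k (1+4π²|k|²)^s`. -/
theorem stmt7 (N : ℕ) (hN : 1 ≤ N) (s : ℝ) (hs₁ : -1 < s) (hs₂ : s < 0) :
    ∃ C : ℝ, 0 < C ∧
      ∀ T : ℝ, 0 < T → T ≤ 1 →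
        ∀ β : (Fin N → ℤ) → ℝ, (∀ k, 0 ≤ β k) →
          Summable (fun k : Fin N → ℤ =>
            β k * (1 + 4 * π ^ 2 * ∑ i, (k i : ℝ) ^ 2) ^ s) →
          (∫ t in Set.Ioc (0 : ℝ) T,
              (∑' k : Fin N → ℤ,
                β k * Real.exp (-8 * π ^ 2 * (∑ i, (k i : ℝ) ^ 2) * t)) ^ (2 / (1 - s)))
            ^ ((1 - s) / 2) ≤
          C * T ^ ((1 + s) / 2) *
            ∑' k : Fin N → ℤ, β k * (1 + 4 * π ^ 2 * ∑ i, (k i : ℝ) ^ 2) ^ s := by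
  refine ⟨2, by norm_num, fun T hT hT1 β hβ hsum => ?_⟩
  set l : (Fin N → ℤ) → ℝ := fun k => 4 * π ^ 2 * ∑ i, (k i : ℝ) ^ 2 with hl
  have hl0 : ∀ k, 0 ≤ l k := fun k => by positivity
  have hexp : ∀ (k : Fin N → ℤ) (t : ℝ),
      -8 * π ^ 2 * (∑ i, (k i : ℝ) ^ 2) * t = -(2 * l k) * t := fun k t => by
    simp only [hl]; ring
  simp only [hexp]
  change Summable (fun k => β k * (1 + l k) ^ s) at hsum
  change _ ≤ 2 * T ^ ((1 + s) / 2) * ∑' k, β k * (1 + l k) ^ s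
  set p : ℝ := 2 / (1 - s) with hp
  have h1s : 0 < 1 - s := by linarith
  have hp1 : 1 ≤ p := by rw [hp, le_div_iff₀ h1s]; linarith
  have hp0 : 0 < p := by linarith
  have hpinv : (1 - s) / 2 = p⁻¹ := by rw [hp, inv_div]
  have hw0 : ∀ k, 0 ≤ β k * (1 + l k) ^ s := fun k =>
    mul_nonneg (hβ k) (Real.rpow_nonneg (by linarith [hl0 k]) _)
  set S := ∑' k, β k * (1 + l k) ^ s with hS
  have hS0 : 0 ≤ S := tsum_nonneg hw0
  set w : (Fin N → ℤ) → ENNReal := fun k => ENNReal.ofReal (β k * (1 + l k) ^ s) with hw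
  have hwS : ∑' k, w k = ENNReal.ofReal S := (ENNReal.ofReal_tsum_of_nonneg hw0 hsum).symm
  set a : (Fin N → ℤ) → ℝ → ENNReal := fun k t =>
    ENNReal.ofReal ((1 + l k) ^ (-s) * Real.exp (-(2 * l k) * t)) with ha
  set M := 2 * T ^ ((1 + s) / 2) with hM
  have hM0 : 0 ≤ M := by positivity
  have hF0 : ∀ t, 0 ≤ ∑' k, β k * Real.exp (-(2 * l k) * t) := fun t =>
    tsum_nonneg fun k => mul_nonneg (hβ k) (Real.exp_pos _).le
  have hpt : ∀ t, ‖(∑' k, β k * Real.exp (-(2 * l k) * t)) ^ p‖ₑ ≤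
      ENNReal.ofReal S ^ (p - 1) * ∑' k, w k * a k t ^ p := fun t => by
    rw [Real.enorm_of_nonneg (Real.rpow_nonneg (hF0 t) _),
      ← ENNReal.ofReal_rpow_of_nonneg (hF0 t) hp0.le, ← hwS]
    refine le_trans ?_ (ENNReal.tsum_mul_rpow_le w (fun k => a k t) hp1)
    refine ENNReal.rpow_le_rpow ((ENNReal.ofReal_tsum_le fun k =>
      mul_nonneg (hβ k) (Real.exp_pos _).le).trans_eq (tsum_congr fun k => ?_)) hp0.le
    have hk : 0 < 1 + l k := by linarith [hl0 k]
    rw [hw, ha, ← ENNReal.ofReal_mul (hw0 k), Real.rpow_neg hk.le]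
    have := (Real.rpow_pos_of_pos hk s).ne'
    congr 1
    field_simp
  have hX : ENNReal.ofReal (∫ t in Set.Ioc (0 : ℝ) T,
      (∑' k, β k * Real.exp (-(2 * l k) * t)) ^ p) ≤ ENNReal.ofReal ((M * S) ^ p) := by
    rw [← Real.enorm_of_nonneg (integral_nonneg fun t => Real.rpow_nonneg (hF0 t) _)]
    calc _ ≤ ∫⁻ t in Set.Ioc (0 : ℝ) T, ‖(∑' k, β k * Real.exp (-(2 * l k) * t)) ^ p‖ₑ :=
          enorm_integral_le_lintegral_enorm _
      _ ≤ ∫⁻ t in Set.Ioc (0 : ℝ) T, ENNReal.ofReal S ^ (p - 1) * ∑' k, w k * a k t ^ p :=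
          lintegral_mono hpt
      _ = ENNReal.ofReal S ^ (p - 1) * ∑' k, w k * ∫⁻ t in Set.Ioc (0 : ℝ) T, a k t ^ p := by
          rw [lintegral_const_mul _ (by fun_prop), lintegral_tsum fun k => by fun_prop]
          congr 1
          exact tsum_congr fun k => lintegral_const_mul _ (by fun_prop)
      _ ≤ ENNReal.ofReal S ^ (p - 1) * ∑' k, w k * ENNReal.ofReal (M ^ p) := by
          gcongr with k
          exact lintegral_weighted_exp_rpow_le hs₁ hs₂ (hl0 k) hT hT1
      _ = ENNReal.ofReal ((M * S) ^ p) := by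
          rw [ENNReal.tsum_mul_right, hwS, ENNReal.ofReal_rpow_of_nonneg hS0 (by linarith),
            ← ENNReal.ofReal_mul hS0, ← ENNReal.ofReal_mul (by positivity),
            Real.mul_rpow hM0 hS0]
          have : S ^ p = S ^ (p - 1) * S := by
            conv_lhs => rw [← sub_add_cancel p 1]
            rw [Real.rpow_add_of_nonneg hS0 (by linarith) zero_le_one, Real.rpow_one]
          rw [this]
          congr 1
          ring
  rw [hpinv]
  refine (Real.rpow_le_rpow (integral_nonneg fun t => Real.rpow_nonneg (hF0 t) _)
    ((ENNReal.ofReal_le_ofReal_iff (by positivity)).1 hX) (by positivity)).trans_eq ?_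
  rw [← Real.rpow_mul (by positivity), mul_inv_cancel₀ hp0.ne', Real.rpow_one]
end

section
/- Let N ∈ {2,3}, −1 + N/4 < s < 0 and 0 < T ≤ 1. There is a constant C = C(s,N) such that for every family (β_k)_{k∈ℤ^N} of nonnegative reals with ∑_{k∈ℤ^N} β_k (1+4π²|k|²)^s < ∞, one has ‖ ∑_{k∈ℤ^N} β_k e^{−8π²|k|² t} ‖_{L^{4/(4−N)}(0,T)} ≤ C T^{s+(4−N)/4} ∑_{k∈ℤ^N} β_k (1+4π²|k|²)^s. -/
open MeasureTheory Real

/-- For `-1 ≤ s ≤ 0`, the heat factor `e^{-2 l t}` is controlled by `t ^ s (1 + l) ^ s`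
on `0 < t ≤ 1`. -/
theorem exp_neg_two_mul_le_rpow_mul_rpow {s t l : ℝ} (hs₁ : -1 ≤ s) (hs₂ : s ≤ 0)
    (ht : 0 < t) (ht₁ : t ≤ 1) (hl : 0 ≤ l) :
    Real.exp (-(2 * l * t)) ≤ 2 * t ^ s * (1 + l) ^ s := by
  have hx : 0 < t * (1 + l) := by positivity
  have hlt : 0 ≤ l * t := by positivity
  have hpow : (t * (1 + l)) ^ (-s) ≤ 1 + t * (1 + l) := by
    calc (t * (1 + l)) ^ (-s) ≤ (1 + t * (1 + l)) ^ (-s) :=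
          Real.rpow_le_rpow hx.le (by linarith) (by linarith)
      _ ≤ (1 + t * (1 + l)) ^ (1 : ℝ) :=
          Real.rpow_le_rpow_of_exponent_le (by linarith) (by linarith)
      _ = 1 + t * (1 + l) := Real.rpow_one _
  have hexp : (t * (1 + l)) ^ (-s) ≤ 2 * Real.exp (2 * l * t) := by
    have := Real.add_one_le_exp (2 * l * t)
    nlinarith
  rw [mul_assoc 2 (t ^ s), ← Real.mul_rpow ht.le (by linarith), Real.exp_neg]
  rw [Real.rpow_neg hx.le] at hexp
  have hp : 0 < (t * (1 + l)) ^ s := Real.rpow_pos_of_pos hx s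
  rw [inv_le_iff_one_le_mul₀ (Real.exp_pos _)]
  rw [inv_le_iff_one_le_mul₀ hp] at hexp
  linarith

/-- A nonnegative function bounded by `A t ^ s` on `(0, T]` has `L ^ p` norm at most
`A (s p + 1) ^ (-1/p) T ^ (s + 1/p)`, provided `s p > -1`. -/
theorem rpow_setIntegral_Ioc_le_of_le_rpow {f : ℝ → ℝ} {A T s p : ℝ} (hA : 0 ≤ A) (hT : 0 < T)
    (hp : 0 < p) (hsp : -1 < s * p) (hf : ∀ t ∈ Set.Ioc 0 T, 0 ≤ f t)
    (hfA : ∀ t ∈ Set.Ioc 0 T, f t ≤ A * t ^ s) :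
    (∫ t in Set.Ioc 0 T, f t ^ p) ^ p⁻¹ ≤ A * ((s * p + 1)⁻¹) ^ p⁻¹ * T ^ (s + p⁻¹) := by
  have hc : 0 < s * p + 1 := by linarith
  have hint : IntegrableOn (fun t : ℝ => A ^ p * t ^ (s * p)) (Set.Ioc 0 T) :=
    (((intervalIntegral.intervalIntegrable_rpow' hsp).const_mul _).1 :)
  have hle : ∫ t in Set.Ioc 0 T, f t ^ p ≤ ∫ t in Set.Ioc 0 T, A ^ p * t ^ (s * p) := by
    refine integral_mono_of_nonneg ?_ hint ?_
    · filter_upwards [ae_restrict_mem measurableSet_Ioc] with t ht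
      exact Real.rpow_nonneg (hf t ht) p
    · filter_upwards [ae_restrict_mem measurableSet_Ioc] with t ht
      have := Real.rpow_le_rpow (hf t ht) (hfA t ht) hp.le
      rwa [Real.mul_rpow hA (Real.rpow_nonneg ht.1.le s), ← Real.rpow_mul ht.1.le] at this
  have hval : ∫ t in Set.Ioc 0 T, A ^ p * t ^ (s * p) =
      A ^ p * (s * p + 1)⁻¹ * T ^ (s * p + 1) := by
    rw [integral_const_mul, ← intervalIntegral.integral_of_le hT.le, integral_rpow (Or.inl hsp),
      Real.zero_rpow hc.ne']
    ring
  have hnonneg : 0 ≤ ∫ t in Set.Ioc 0 T, f t ^ p :=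
    setIntegral_nonneg measurableSet_Ioc fun t ht => Real.rpow_nonneg (hf t ht) p
  calc (∫ t in Set.Ioc 0 T, f t ^ p) ^ p⁻¹
      ≤ (A ^ p * (s * p + 1)⁻¹ * T ^ (s * p + 1)) ^ p⁻¹ :=
        Real.rpow_le_rpow hnonneg (hle.trans_eq hval) (by positivity)
    _ = A * ((s * p + 1)⁻¹) ^ p⁻¹ * T ^ (s + p⁻¹) := by
        rw [Real.mul_rpow (by positivity) (by positivity),
          Real.mul_rpow (by positivity) (by positivity), Real.rpow_rpow_inv hA hp.ne',
          ← Real.rpow_mul hT.le]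
        congr 2
        field_simp

/-- for `N ∈ {2,3}`, `−1 + N/4 < s < 0`, there is `C = C(s,N)` such that
for all `0 < T ≤ 1` and all nonnegative `(β_k)_{k ∈ ℤ^N}` with
`∑_k β_k (1+4π²|k|²)^s < ∞` one has
`‖ ∑_k β_k e^{−8π²|k|² t} ‖_{L^{4/(4−N)}(0,T)} ≤ C T^{s+(4−N)/4} ∑_k β_k (1+4π²|k|²)^s`. -/
theorem stmt8 (N : ℕ) (hN : N = 2 ∨ N = 3) (s : ℝ) (hs₁ : -1 + (N : ℝ) / 4 < s)
    (hs₂ : s < 0) :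
    ∃ C : ℝ, 0 < C ∧
      ∀ T : ℝ, 0 < T → T ≤ 1 →
        ∀ β : (Fin N → ℤ) → ℝ, (∀ k, 0 ≤ β k) →
          Summable (fun k : Fin N → ℤ =>
            β k * (1 + 4 * π ^ 2 * ∑ i, (k i : ℝ) ^ 2) ^ s) →
          (∫ t in Set.Ioc (0 : ℝ) T,
              (∑' k : Fin N → ℤ,
                β k * Real.exp (-8 * π ^ 2 * (∑ i, (k i : ℝ) ^ 2) * t))
                ^ (4 / (4 - (N : ℝ)))) ^ ((4 - (N : ℝ)) / 4) ≤
          C * T ^ (s + (4 - (N : ℝ)) / 4) *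
            ∑' k : Fin N → ℤ, β k * (1 + 4 * π ^ 2 * ∑ i, (k i : ℝ) ^ 2) ^ s := by
  have hN4 : 0 < 4 - (N : ℝ) := by rcases hN with rfl | rfl <;> norm_num
  have hinv : (4 - (N : ℝ)) / 4 = (4 / (4 - (N : ℝ)))⁻¹ := (inv_div _ _).symm
  have hp : 0 < 4 / (4 - (N : ℝ)) := by positivity
  have hsp : -1 < s * (4 / (4 - (N : ℝ))) := by
    rw [mul_div_assoc', lt_div_iff₀ hN4]
    linarith
  have hs : -1 ≤ s := by
    have : (0 : ℝ) ≤ N := N.cast_nonneg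
    linarith
  rw [hinv]
  set p : ℝ := 4 / (4 - (N : ℝ))
  have hc : 0 < s * p + 1 := by linarith
  refine ⟨2 * ((s * p + 1)⁻¹) ^ p⁻¹, by positivity, fun T hT hT₁ β hβ hsum => ?_⟩
  have hS : 0 ≤ ∑' k : Fin N → ℤ, β k * (1 + 4 * π ^ 2 * ∑ i, (k i : ℝ) ^ 2) ^ s :=
    tsum_nonneg fun k => mul_nonneg (hβ k) (by positivity)
  refine (rpow_setIntegral_Ioc_le_of_le_rpow
    (mul_nonneg zero_le_two hS) hT hp hsp (fun t _ => ?_) (fun t ht => ?_)).trans_eq (by ring)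
  · exact tsum_nonneg fun k => mul_nonneg (hβ k) (Real.exp_pos _).le
  · have hterm : ∀ k : Fin N → ℤ,
        β k * Real.exp (-8 * π ^ 2 * (∑ i, (k i : ℝ) ^ 2) * t) ≤
          2 * t ^ s * (β k * (1 + 4 * π ^ 2 * ∑ i, (k i : ℝ) ^ 2) ^ s) := fun k => by
      have h := exp_neg_two_mul_le_rpow_mul_rpow (l := 4 * π ^ 2 * ∑ i, (k i : ℝ) ^ 2)
        hs hs₂.le ht.1 (ht.2.trans hT₁) (by positivity)
      rw [show -8 * π ^ 2 * (∑ i, (k i : ℝ) ^ 2) * t =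
        -(2 * (4 * π ^ 2 * ∑ i, (k i : ℝ) ^ 2) * t) by ring]
      exact (mul_le_mul_of_nonneg_left h (hβ k)).trans_eq (by ring)
    have hsum' := hsum.mul_left (2 * t ^ s)
    have hexp := Summable.of_nonneg_of_le
      (fun k => mul_nonneg (hβ k) (Real.exp_pos _).le) hterm hsum'
    refine (hexp.tsum_le_tsum hterm hsum').trans_eq ?_
    rw [tsum_mul_left]
    ring
end
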